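/- There is an absolute constant C > 0 with the following property. Let T be a finite rooted binary tree with leaf assignment χ, let P(T) be any path decomposition of T, and let p ∈ P(T). If p is tall, then Σ_{v ∈ p} log(1 + |H_v|) ≤ C · |p| · log(1 + |p|); if p is short, then Σ_{v ∈ p} log(1 + |H_v|) ≤ C · |H_p| · log(1 + |H_p|). -/

import Mathlib

open scoped Classical
noncomputable section

/-- A finite rooted binary tree on vertex set `V`: every non-root vertex has a parent,
the root has none, depths are consistent (ensuring acyclicity), and each vertex has
at most two children. -/
structure RBTree (V : Type) [Fintype V] [DecidableEq V] where
  parent : V → Option V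
  root : V
  depth : V → ℕ
  parent_root : parent root = none
  root_of_parent_none : ∀ v, parent v = none → v = root
  depth_parent : ∀ v u, parent v = some u → depth v = depth u + 1
  binary : ∀ v : V, (Finset.univ.filter (fun c => parent c = some v)).card ≤ 2

namespace RBTree

variable {V : Type} [Fintype V] [DecidableEq V]

/-- The children of a vertex. -/
def children (T : RBTree V) (v : V) : Finset V :=
  Finset.univ.filter (fun c => T.parent c = some v)

/-- A leaf is a vertex with no children. -/
def IsLeaf (T : RBTree V) (v : V) : Prop := T.children v = ∅

/-- Iterated parent map. -/
def parentIter (T : RBTree V) : ℕ → V → Option V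
  | 0, v => some v
  | n + 1, v => (T.parentIter n v).bind T.parent

/-- `u` is a (weak) ancestor of `v`: `u` lies on the path from `v` to the root
(including `v` itself). -/
def Anc (T : RBTree V) (u v : V) : Prop := ∃ n, T.parentIter n v = some u

/-- `u` is a strict ancestor of `v`. -/
def StrictAnc (T : RBTree V) (u v : V) : Prop := ∃ n, 0 < n ∧ T.parentIter n v = some u

/-- `L(T_v)`: the leaves of the subtree rooted at `v`. -/
def subtreeLeaves (T : RBTree V) (v : V) : Finset V :=
  Finset.univ.filter (fun l => T.IsLeaf l ∧ T.Anc v l)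

/-- A leaf assignment `χ` assigns to each internal vertex a set of leaves containing
exactly one leaf from the subtree of each of its children (and nothing else);
leaves are assigned the empty set. -/
structure LeafAssignment (T : RBTree V) where
  χ : V → Finset V
  mem_leaf : ∀ v l, l ∈ χ v → T.IsLeaf l
  mem_desc : ∀ v l, l ∈ χ v → ∃ c ∈ T.children v, T.Anc c l
  unique_child : ∀ v, ∀ c ∈ T.children v, ∃! l, l ∈ χ v ∧ T.Anc c l

/-- The heap `H_v = {u ∈ A(v) : χ(u) ∩ L(T_v) ≠ ∅}` of a vertex `v`. -/
def heap (T : RBTree V) (A : T.LeafAssignment) (v : V) : Finset V :=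
  Finset.univ.filter (fun u => T.StrictAnc u v ∧ (A.χ u ∩ T.subtreeLeaves v).Nonempty)

/-- A leaf path: the set of vertices on a monotone path from some leaf `ℓ` up to an
ancestor `b` of `ℓ`. -/
def IsLeafPath (T : RBTree V) (p : Finset V) : Prop :=
  ∃ ℓ b, T.IsLeaf ℓ ∧ T.Anc b ℓ ∧
    p = Finset.univ.filter (fun u => T.Anc u ℓ ∧ T.Anc b u)

/-- The base `b(p)` of a path: its vertex closest to the root. -/
def base (T : RBTree V) (p : Finset V) : V :=
  if h : ∃ b, b ∈ p ∧ ∀ w ∈ p, T.Anc b w then h.choose else T.root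

/-- The leaf `ℓ(p)` of a path. -/
def pathLeaf (T : RBTree V) (p : Finset V) : V :=
  if h : ∃ l, l ∈ p ∧ ∀ w ∈ p, T.Anc w l then h.choose else T.root

/-- `H_p = H_{b(p)}`. -/
def pathHeap (T : RBTree V) (A : T.LeafAssignment) (p : Finset V) : Finset V :=
  T.heap A (T.base p)

/-- A path decomposition: a partition of the vertex set into leaf paths. -/
def IsPathDecomp (T : RBTree V) (P : Finset (Finset V)) : Prop :=
  (∀ p ∈ P, T.IsLeafPath p) ∧ (∀ v : V, ∃! p, p ∈ P ∧ v ∈ p)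

/-- `q` is a child of `p` in the shrub: the parent of `b(q)` lies on `p`. -/
def ShrubParent (T : RBTree V) (p q : Finset V) : Prop :=
  ∃ u, T.parent (T.base q) = some u ∧ u ∈ p

/-- `p` is a strict ancestor of `q` in the shrub: some vertex of `p` is a strict
ancestor of `b(q)` in `T` (and `p ≠ q`). -/
def ShrubStrictAnc (T : RBTree V) (p q : Finset V) : Prop :=
  p ≠ q ∧ ∃ u ∈ p, T.StrictAnc u (T.base q)

/-- Weak ancestor relation in the shrub. -/
def ShrubAnc (T : RBTree V) (p q : Finset V) : Prop :=
  p = q ∨ T.ShrubStrictAnc p q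

/-- A maximum path decomposition w.r.t. a leaf assignment: a path decomposition in
which each internal vertex lies on the same path as a child of maximal heap size. -/
def IsMaxPathDecomp (T : RBTree V) (A : T.LeafAssignment) (P : Finset (Finset V)) : Prop :=
  T.IsPathDecomp P ∧
    ∀ p ∈ P, ∀ v ∈ p, ∀ c ∈ T.children v, c ∈ p →
      ∀ c' ∈ T.children v, (T.heap A c').card ≤ (T.heap A c).card

/-- A path `p` is short if `|p| < sqrt(|H_p|)/100`. -/
def IsShort (T : RBTree V) (A : T.LeafAssignment) (p : Finset V) : Prop :=
  (p.card : ℝ) < Real.sqrt ((T.pathHeap A p).card) / 100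

/-- The tall support chain of a path `p`: the maximal chain of tall paths in the shrub
starting at the parent of `p` and going up. -/
def TallChain (T : RBTree V) (A : T.LeafAssignment) (P : Finset (Finset V)) (p : Finset V) :
    Finset (Finset V) :=
  P.filter (fun q => T.ShrubStrictAnc q p ∧
    ∀ r ∈ P, T.ShrubStrictAnc r p → T.ShrubAnc q r → ¬ T.IsShort A r)

/-- A short path is supported if at least `|H_p|/100` of the vertices of `H_p` lie on
paths of its tall support chain. -/
def IsSupported (T : RBTree V) (A : T.LeafAssignment) (P : Finset (Finset V))
    (p : Finset V) : Prop :=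
  ((T.pathHeap A p).card : ℝ) / 100 ≤
    (((T.pathHeap A p).filter (fun v => ∃ q ∈ T.TallChain A P p, v ∈ q)).card : ℝ)

/-- The reduced heap `H̃_p`: vertices of `H_p` not lying on the tall support chain. -/
def redHeap (T : RBTree V) (A : T.LeafAssignment) (P : Finset (Finset V))
    (p : Finset V) : Finset V :=
  (T.pathHeap A p).filter (fun v => ∀ q ∈ T.TallChain A P p, v ∉ q)

/-- `q` is the parent of the unsupported short path `p` in the shrub forest of
unsupported short paths: `q` is the first short path on the chain of strict shrub
ancestors of `p`. -/
def ForestParent (T : RBTree V) (A : T.LeafAssignment) (P : Finset (Finset V))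
    (q p : Finset V) : Prop :=
  q ∈ P ∧ p ∈ P ∧ T.IsShort A q ∧ T.IsShort A p ∧ ¬ T.IsSupported A P p ∧
    T.ShrubStrictAnc q p ∧
    ∀ r ∈ P, T.ShrubStrictAnc r p → T.ShrubStrictAnc q r → ¬ T.IsShort A r

/-- `U` is the connected component of the shrub forest of unsupported short paths
rooted at the supported short path `r`. -/
def IsComponent (T : RBTree V) (A : T.LeafAssignment) (P : Finset (Finset V))
    (U : Finset (Finset V)) (r : Finset V) : Prop :=
  U ⊆ P ∧ r ∈ U ∧ T.IsShort A r ∧ T.IsSupported A P r ∧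
    (∀ p ∈ U, T.IsShort A p) ∧
    (∀ p ∈ U, p ≠ r → ¬ T.IsSupported A P p) ∧
    (∀ p ∈ U, p ≠ r → ∃ q ∈ U, T.ForestParent A P q p) ∧
    (∀ q ∈ U, ∀ p ∈ P, T.ForestParent A P q p → p ∈ U)

/-- `q` lies in the subtree of the shrub forest rooted at `p`. -/
def ForestDesc (T : RBTree V) (A : T.LeafAssignment) (P : Finset (Finset V))
    (p q : Finset V) : Prop :=
  Relation.ReflTransGen (fun a b => T.ForestParent A P a b) p q

/-- `U_p`: the nodes of `U` in the subtree of the shrub forest rooted at `p`. -/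
def usub (T : RBTree V) (A : T.LeafAssignment) (P : Finset (Finset V))
    (U : Finset (Finset V)) (p : Finset V) : Finset (Finset V) :=
  U.filter (fun q => T.ForestDesc A P p q)

/-- The children of `p` in the shrub forest (within `U`). -/
def forestChildren (T : RBTree V) (A : T.LeafAssignment) (P : Finset (Finset V))
    (U : Finset (Finset V)) (p : Finset V) : Finset (Finset V) :=
  U.filter (fun q => T.ForestParent A P p q)

/-- The residue `R_p = |H̃_p| − Σ_{q child of p} |H̃_q|`. -/
def residue (T : RBTree V) (A : T.LeafAssignment) (P : Finset (Finset V))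
    (U : Finset (Finset V)) (p : Finset V) : ℤ :=
  ((T.redHeap A P p).card : ℤ) -
    ∑ q ∈ T.forestChildren A P U p, ((T.redHeap A P q).card : ℤ)

/-- `R⁺_p = max(R_p, 0)`. -/
def resPlus (T : RBTree V) (A : T.LeafAssignment) (P : Finset (Finset V))
    (U : Finset (Finset V)) (p : Finset V) : ℤ :=
  max (T.residue A P U p) 0

/-- The weight `W_p = Σ_{q ∈ U_p} R⁺_q`. -/
def weight (T : RBTree V) (A : T.LeafAssignment) (P : Finset (Finset V))
    (U : Finset (Finset V)) (p : Finset V) : ℤ :=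
  ∑ q ∈ T.usub A P U p, T.resPlus A P U q

end RBTree

namespace RBTree

variable {V : Type} [Fintype V] [DecidableEq V]

theorem parentIter_add (T : RBTree V) (m n : ℕ) (v : V) :
    T.parentIter (m + n) v = (T.parentIter m v).bind (T.parentIter n) := by
  induction n with
  | zero =>
    have h : T.parentIter 0 = some := rfl
    simp [h]
  | succ n ih =>
    have h : T.parentIter (n + 1) = fun w => (T.parentIter n w).bind T.parent := rfl
    rw [← Nat.add_assoc, h, ← Option.bind_assoc, ← ih]
    rfl

theorem Anc.refl (T : RBTree V) (v : V) : T.Anc v v := ⟨0, rfl⟩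

theorem Anc.trans {T : RBTree V} {u v w : V} (huv : T.Anc u v) (hvw : T.Anc v w) :
    T.Anc u w := by
  obtain ⟨n, hn⟩ := huv
  obtain ⟨m, hm⟩ := hvw
  exact ⟨m + n, by rw [parentIter_add, hm]; exact hn⟩

theorem StrictAnc.anc {T : RBTree V} {u v : V} (h : T.StrictAnc u v) : T.Anc u v :=
  let ⟨n, _, hn⟩ := h
  ⟨n, hn⟩

/-- Any two ancestors of a vertex are comparable. -/
theorem Anc.anc_or_strictAnc {T : RBTree V} {u v w : V} (hu : T.Anc u w) (hv : T.Anc v w) :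
    T.Anc u v ∨ T.StrictAnc v u := by
  obtain ⟨m, hm⟩ := hu
  obtain ⟨n, hn⟩ := hv
  rcases le_or_gt n m with h | h
  · obtain ⟨k, rfl⟩ := Nat.exists_eq_add_of_le h
    rw [parentIter_add, hn] at hm
    exact Or.inl ⟨k, hm⟩
  · obtain ⟨k, rfl⟩ := Nat.exists_eq_add_of_lt h
    rw [Nat.add_assoc, parentIter_add, hm] at hn
    exact Or.inr ⟨k + 1, k.succ_pos, hn⟩

theorem IsLeafPath.base_spec {T : RBTree V} {p : Finset V} (hp : T.IsLeafPath p) :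
    T.base p ∈ p ∧ ∀ w ∈ p, T.Anc (T.base p) w := by
  have h : ∃ b, b ∈ p ∧ ∀ w ∈ p, T.Anc b w := by
    obtain ⟨l, b, -, hb, rfl⟩ := hp
    exact ⟨b, by simp [hb, Anc.refl], fun w hw => (Finset.mem_filter.1 hw).2.2⟩
  rw [base, dif_pos h]
  exact h.choose_spec

/-- On a leaf path, the heap of a vertex consists of vertices of the path and of the heap of
its base. -/
theorem IsLeafPath.card_heap_le {T : RBTree V} (A : T.LeafAssignment) {p : Finset V}
    (hp : T.IsLeafPath p) {v : V} (hv : v ∈ p) :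
    (T.heap A v).card ≤ (T.pathHeap A p).card + p.card := by
  obtain ⟨hbp, hbase⟩ := hp.base_spec
  refine (Finset.card_le_card fun u hu => ?_).trans (Finset.card_union_le _ _)
  obtain ⟨-, huv, l, hl⟩ := Finset.mem_filter.1 hu
  obtain ⟨hlu, hlv⟩ := Finset.mem_inter.1 hl
  obtain ⟨-, hleaf, hvl⟩ := Finset.mem_filter.1 hlv
  rcases (hbase v hv).anc_or_strictAnc huv.anc with h | h
  · refine Finset.mem_union_right _ ?_
    obtain ⟨l', b, -, -, rfl⟩ := hp
    exact Finset.mem_filter.2 ⟨Finset.mem_univ _, huv.anc.trans (Finset.mem_filter.1 hv).2.1,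
      (Finset.mem_filter.1 hbp).2.2.trans h⟩
  · exact Finset.mem_union_left _ (Finset.mem_filter.2 ⟨Finset.mem_univ _, h, l,
      Finset.mem_inter.2 ⟨hlu, Finset.mem_filter.2
        ⟨Finset.mem_univ _, hleaf, (hbase v hv).trans hvl⟩⟩⟩)

/-- A uniform bound `|H_v| + 1 ≤ (1 + x) ^ k` along a path bounds the sum of logarithms. -/
theorem sum_log_heap_le (T : RBTree V) (A : T.LeafAssignment) (p : Finset V) (x : ℝ) (k : ℕ)
    (h : ∀ v ∈ p, 1 + ((T.heap A v).card : ℝ) ≤ (1 + x) ^ k) :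
    ∑ v ∈ p, Real.log (1 + ((T.heap A v).card : ℝ)) ≤ p.card * (k * Real.log (1 + x)) := by
  rw [← nsmul_eq_mul]
  refine Finset.sum_le_card_nsmul _ _ _ fun v hv => ?_
  rw [← Real.log_pow]
  exact Real.log_le_log (by positivity) (h v hv)

end RBTree

open RBTree in
/-- there is an absolute constant `C > 0` such that for any path `p` of a
path decomposition: if `p` is tall then `Σ_{v ∈ p} log(1 + |H_v|) ≤ C·|p|·log(1+|p|)`,
and if `p` is short then `Σ_{v ∈ p} log(1 + |H_v|) ≤ C·|H_p|·log(1+|H_p|)`. -/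
theorem tall_short_path_bounds :
    ∃ C : ℝ, 0 < C ∧
      ∀ (V : Type) [Fintype V] [DecidableEq V] (T : RBTree V) (A : T.LeafAssignment)
        (P : Finset (Finset V)), T.IsPathDecomp P → ∀ p ∈ P,
        (¬ T.IsShort A p →
          ∑ v ∈ p, Real.log (1 + ((T.heap A v).card : ℝ)) ≤
            C * (p.card : ℝ) * Real.log (1 + (p.card : ℝ))) ∧
        (T.IsShort A p →
          ∑ v ∈ p, Real.log (1 + ((T.heap A v).card : ℝ)) ≤
            C * ((T.pathHeap A p).card : ℝ) *
              Real.log (1 + ((T.pathHeap A p).card : ℝ))) := by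
  refine ⟨16, by norm_num, fun V _ _ T A P hP p hpP => ?_⟩
  have hp := hP.1 p hpP
  have hn : (1 : ℝ) ≤ p.card := by
    exact_mod_cast Finset.card_pos.2 ⟨_, hp.base_spec.1⟩
  have hH : (0 : ℝ) ≤ (T.pathHeap A p).card := by positivity
  have hheap : ∀ v ∈ p, ((T.heap A v).card : ℝ) ≤ (T.pathHeap A p).card + p.card :=
    fun v hv => by exact_mod_cast hp.card_heap_le A hv
  unfold IsShort
  generalize hm : ((T.pathHeap A p).card : ℝ) = m at *
  constructor
  · intro htall
    have hm2 : m ≤ (100 * p.card : ℝ) ^ 2 := Real.sqrt_le_iff.1 (by linarith) |>.2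
    refine (T.sum_log_heap_le A p p.card 16 fun v hv => ?_).trans_eq (by push_cast; ring)
    have h2 : (2 : ℝ) ^ 14 ≤ (1 + (p.card : ℝ)) ^ 14 := by gcongr; linarith
    calc 1 + ((T.heap A v).card : ℝ) ≤ 2 ^ 14 * (1 + (p.card : ℝ)) ^ 2 := by
          nlinarith [hheap v hv]
      _ ≤ (1 + (p.card : ℝ)) ^ 14 * (1 + (p.card : ℝ)) ^ 2 := by gcongr
      _ = (1 + (p.card : ℝ)) ^ 16 := by ring
  · intro hshort
    have hnm : (p.card : ℝ) ≤ m := by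
      nlinarith [Real.sq_sqrt hH, Real.sqrt_nonneg m]
    have hlog : 0 ≤ Real.log (1 + m) := Real.log_nonneg (by linarith)
    calc ∑ v ∈ p, Real.log (1 + ((T.heap A v).card : ℝ))
        ≤ p.card * ((2 : ℕ) * Real.log (1 + m)) :=
          T.sum_log_heap_le A p m 2 fun v hv => by nlinarith [hheap v hv]
      _ ≤ m * (16 * Real.log (1 + m)) := by
          push_cast
          gcongr
          norm_num
      _ = 16 * m * Real.log (1 + m) := by ring
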